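/- The slow-roll curve θ_SR(T) := −arcsin(T/(3(1−T))) satisfies θ_SR(0) = 0, θ_SR′(0) = −1/3, θ_SR″(0) = −2/3, θ_SR‴(0) = −55/27, and θ_SR⁗(0) = −76/9; equivalently its Maclaurin expansion is θ_SR(T) = −(1/3)(T + T² + (55/54)T³ + (19/18)T⁴) + O(T⁵) as T → 0. In particular, it agrees with the center manifold expansion θ = −(1/3)(T + T² + (26/27)T³ + ...) of the attractor solution only through second order, the third-order coefficients differing (55/54 ≠ 26/27). -/

import Mathlib

open Real Set Filter Asymptotics

/-- The slow-roll curve θ_SR(T) = −arcsin(T/(3(1−T))) for the quadratic potential. -/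
noncomputable def thetaSR : ℝ → ℝ := fun T => -Real.arcsin (T / (3 * (1 - T)))

/-- On `T < 3/4` the slow-roll curve is smooth because `9 - 18T + 8T² = (3 - 2T)(3 - 4T)` is
positive. -/
lemma slowRoll_radicand_pos {T : ℝ} (hT : T < 3 / 4) : 0 < 9 - 18 * T + 8 * T ^ 2 := by
  nlinarith [mul_pos (by linarith : 0 < 3 - 2 * T) (by linarith : 0 < 3 - 4 * T)]

lemma hasDerivAt_of_eq {f g : ℝ → ℝ} {f' g' x : ℝ} (h : HasDerivAt f f' x)
    (hfg : ∀ y, g y = f y) (hd : f' = g') : HasDerivAt g g' x := by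
  rwa [funext hfg, ← hd]

lemma hasDerivAt_thetaSR {T : ℝ} (hT : T < 3 / 4) :
    HasDerivAt thetaSR (-(1 / ((1 - T) * √(9 - 18 * T + 8 * T ^ 2)))) T := by
  have hq := slowRoll_radicand_pos hT
  have hs : 0 < 1 - T := by linarith
  have hu : 1 - (T / (3 * (1 - T))) ^ 2 = (9 - 18 * T + 8 * T ^ 2) / (3 * (1 - T)) ^ 2 := by
    field_simp
    ring
  have hpos : 0 < 1 - (T / (3 * (1 - T))) ^ 2 := hu ▸ by positivity
  have h1 : T / (3 * (1 - T)) ≠ -1 := fun h => by rw [h] at hpos; norm_num at hpos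
  have h2 : T / (3 * (1 - T)) ≠ 1 := fun h => by rw [h] at hpos; norm_num at hpos
  have hd : HasDerivAt (fun T : ℝ => T / (3 * (1 - T))) (1 / (3 * (1 - T) ^ 2)) T := by
    refine hasDerivAt_of_eq ((hasDerivAt_id' T).div
      (((hasDerivAt_id' T).const_sub 1).const_mul 3) (by positivity)) (fun _ => rfl) ?_
    field_simp
    ring
  refine hasDerivAt_of_eq ((Real.hasDerivAt_arcsin h1 h2).comp T hd).neg (fun _ => rfl) ?_
  rw [hu, Real.sqrt_div hq.le, Real.sqrt_sq (by positivity)]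
  have := Real.sqrt_pos.2 hq
  field_simp

lemma hasDerivAt_quartic (a b c d e T : ℝ) :
    HasDerivAt (fun T : ℝ => a + b * T + c * T ^ 2 + d * T ^ 3 + e * T ^ 4)
      (b + 2 * c * T + 3 * d * T ^ 2 + 4 * e * T ^ 3) T := by
  have h := hasDerivAt_id' T
  refine hasDerivAt_of_eq (((((h.const_mul b).const_add a).add ((h.pow 2).const_mul c)).add
    ((h.pow 3).const_mul d)).add ((h.pow 4).const_mul e)) (fun _ => rfl) ?_
  norm_num
  ring

/-- The derivative of a function of the form `-N / ((1 - T)ᵃ √q ᵇ)` with `q = 9 - 18T + 8T²`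
has the same form. -/
lemma hasDerivAt_neg_div_pow_mul_sqrt_pow {N : ℝ → ℝ} {N' T : ℝ} (a b : ℕ) (hT : T < 3 / 4)
    (hN : HasDerivAt N N' T) :
    HasDerivAt (fun T => -(N T / ((1 - T) ^ (a + 1) * √(9 - 18 * T + 8 * T ^ 2) ^ (b + 1))))
      (-((N' * (1 - T) * (9 - 18 * T + 8 * T ^ 2) +
        N T * ((a + 1) * (9 - 18 * T + 8 * T ^ 2) + (b + 1) * (1 - T) * (9 - 8 * T))) /
        ((1 - T) ^ (a + 2) * √(9 - 18 * T + 8 * T ^ 2) ^ (b + 3)))) T := by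
  have hq := slowRoll_radicand_pos hT
  have hs : 0 < 1 - T := by linarith
  have hw := Real.sqrt_pos.2 hq
  have hw2 := Real.sq_sqrt hq.le
  have hdq : HasDerivAt (fun T : ℝ => 9 - 18 * T + 8 * T ^ 2) (-18 + 16 * T) T :=
    hasDerivAt_of_eq (hasDerivAt_quartic 9 (-18) 8 0 0 T) (fun _ => by ring) (by ring)
  have hds := ((hasDerivAt_id' T).const_sub 1).pow (a + 1)
  have hdw := (hdq.sqrt hq.ne').pow (b + 1)
  refine hasDerivAt_of_eq (hN.div (hds.mul hdw)
    (by simp only [Pi.mul_apply, Pi.pow_apply]; positivity)).neg (fun _ => rfl) ?_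
  simp only [Pi.mul_apply, Pi.pow_apply, Nat.add_sub_cancel, Nat.cast_add, Nat.cast_one]
  generalize √(9 - 18 * T + 8 * T ^ 2) = w at *
  rw [← hw2]
  field_simp
  ring

lemma analyticAt_thetaSR : AnalyticAt ℝ thetaSR 0 := by
  refine ContDiffAt.analyticAt (ContDiffAt.neg ?_)
  refine ContDiffAt.comp (g := Real.arcsin) (f := fun T : ℝ => T / (3 * (1 - T))) (0 : ℝ)
    (Real.contDiffAt_arcsin (by norm_num) (by norm_num)) ?_
  exact contDiffAt_id.div (contDiffAt_const.mul (contDiffAt_const.sub contDiffAt_id)) (by norm_num)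

/-- The derivatives of the slow-roll curve at the de Sitter fixed point up to fourth order. -/
lemma iteratedDeriv_thetaSR_zero :
    deriv thetaSR 0 = -(1 / 3) ∧ iteratedDeriv 2 thetaSR 0 = -(2 / 3) ∧
      iteratedDeriv 3 thetaSR 0 = -(55 / 27) ∧ iteratedDeriv 4 thetaSR 0 = -(76 / 9) := by
  have hmem : ∀ᶠ T : ℝ in nhds 0, T < 3 / 4 := eventually_lt_nhds (by norm_num)
  have hsqrt : √(9 : ℝ) = 3 := by
    rw [show (9 : ℝ) = 3 ^ 2 by norm_num, Real.sqrt_sq (by norm_num)]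
  have step {f g h : ℝ → ℝ} (hfg : f =ᶠ[nhds 0] g) (hg : ∀ T < 3 / 4, HasDerivAt g (h T) T) :
      deriv f =ᶠ[nhds 0] h :=
    hfg.deriv.trans (hmem.mono fun T hT => (hg T hT).deriv)
  have e1 := step (EventuallyEq.refl _ thetaSR) fun T hT => hasDerivAt_thetaSR hT
  have e2 : deriv (deriv thetaSR) =ᶠ[nhds 0] fun T =>
      -((18 - 35 * T + 16 * T ^ 2) / ((1 - T) ^ 2 * √(9 - 18 * T + 8 * T ^ 2) ^ 3)) := by
    refine step e1 fun T hT => ?_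
    refine hasDerivAt_of_eq (hasDerivAt_neg_div_pow_mul_sqrt_pow 0 0 hT
      (hasDerivAt_const T (1 : ℝ))) (fun T => ?_) ?_
    · simp
    · push_cast
      ring_nf
  have e3 : deriv (deriv (deriv thetaSR)) =ᶠ[nhds 0] fun T =>
      -((495 - 1908 * T + 2711 * T ^ 2 - 1680 * T ^ 3 + 384 * T ^ 4) /
        ((1 - T) ^ 3 * √(9 - 18 * T + 8 * T ^ 2) ^ 5)) := by
    refine step e2 fun T hT => ?_
    refine hasDerivAt_of_eq (hasDerivAt_neg_div_pow_mul_sqrt_pow 1 2 hT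
      (hasDerivAt_quartic 18 (-35) 16 0 0 T)) (fun T => ?_) ?_
    · ring_nf
    · push_cast
      ring_nf
  have e4 : deriv (deriv (deriv (deriv thetaSR))) 0 = -(76 / 9) := by
    rw [e3.deriv_eq]
    refine HasDerivAt.deriv ?_
    refine hasDerivAt_of_eq (hasDerivAt_neg_div_pow_mul_sqrt_pow 2 4
      (by norm_num : (0 : ℝ) < 3 / 4)
      (hasDerivAt_quartic 495 (-1908) 2711 (-1680) 384 0)) (fun T => ?_) ?_
    · ring_nf
    · norm_num [hsqrt]
  simp only [iteratedDeriv_succ, iteratedDeriv_zero]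
  refine ⟨?_, ?_, ?_, e4⟩
  · rw [e1.eq_of_nhds]; norm_num [hsqrt]
  · rw [e2.eq_of_nhds]; norm_num [hsqrt]
  · rw [e3.eq_of_nhds]; norm_num [hsqrt]

/-- The slow-roll curve satisfies θ_SR(0) = 0, θ_SR′(0) = −1/3,
θ_SR″(0) = −2/3, θ_SR‴(0) = −55/27, θ_SR⁗(0) = −76/9, i.e. its Maclaurin expansion is
θ_SR(T) = −(1/3)(T + T² + (55/54)T³ + (19/18)T⁴) + O(T⁵); in particular it agrees with
the center manifold expansion −(1/3)(T + T² + (26/27)T³ + ...) only through second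
order, since 55/54 ≠ 26/27. -/
theorem stmt_17 :
    thetaSR 0 = 0 ∧
    deriv thetaSR 0 = -(1/3) ∧
    iteratedDeriv 2 thetaSR 0 = -(2/3) ∧
    iteratedDeriv 3 thetaSR 0 = -(55/27) ∧
    iteratedDeriv 4 thetaSR 0 = -(76/9) ∧
    (fun T => thetaSR T + (1/3) * (T + T^2 + (55/54) * T^3 + (19/18) * T^4))
      =O[nhds (0:ℝ)] (fun T => T^5) ∧
    (55:ℝ)/54 ≠ 26/27 := by
  obtain ⟨h1, h2, h3, h4⟩ := iteratedDeriv_thetaSR_zero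
  have h0 : thetaSR 0 = 0 := by simp [thetaSR]
  refine ⟨h0, h1, h2, h3, h4, ?_, by norm_num⟩
  have hO := analyticAt_thetaSR.hasFPowerSeriesAt.isBigO_sub_partialSum_pow 5
  refine (hO.congr_left fun T => ?_).trans ?_
  · simp [FormalMultilinearSeries.partialSum, Finset.sum_range_succ, Nat.factorial,
      FormalMultilinearSeries.ofScalars, h0, h1, h2, h3, h4]
    ring
  · exact (isBigO_refl (fun T : ℝ => T) (nhds 0)).norm_left.pow 5
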